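/- The intersection of the two Bruhat intervals [w̃_l, w_l^{L_l} w̃_l] and [w̃_l^c, w_l^{L_l^c} w̃_l^c] within the Bessel support B(SO_{2l}) equals [w̃_{l−1}, w_l^{L_{l−1,1}} w̃_{l−1}] ∩ B(SO_{2l}); equivalently, an element of B(SO_{2l}) lies in both Siegel intervals if and only if it lies in B_{l−1}(SO_{2l}), the set of elements w = t_l(w')w̃_l with cwc = w. -/

import Mathlib

noncomputable section

/-- The order-reversing involution `i ↦ 2l-1-i` of `Fin (2l)`. -/
def revF (l : ℕ) (i : Fin (2*l)) : Fin (2*l) :=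
  ⟨2*l-1-(i:ℕ), by have := i.isLt; omega⟩

/-- Membership in the Weyl group of type `D_l`, realized as the group of permutations of
`Fin (2l)` commuting with `rev` and with an even number of "sign changes". -/
def inWeylD (l : ℕ) (σ : Equiv.Perm (Fin (2*l))) : Prop :=
  (∀ i, σ (revF l i) = revF l (σ i)) ∧
  Even (Finset.univ.filter
    (fun i : Fin (2*l) => (i:ℕ) < l ∧ l ≤ ((σ i : Fin (2*l)) : ℕ))).card

/-- The action of a (signed) permutation on root vectors `v : Fin l → ℤ`
(in the basis `e_1, …, e_l`). -/
def actD (l : ℕ) (σ : Equiv.Perm (Fin (2*l))) (v : Fin l → ℤ) : Fin l → ℤ :=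
  fun k => ∑ i : Fin l,
    v i * (if ((σ (Fin.castLE (by omega) i) : Fin (2*l)) : ℕ) = (k:ℕ) then 1
      else if ((σ (Fin.castLE (by omega) i) : Fin (2*l)) : ℕ) = 2*l-1-(k:ℕ) then -1 else 0)

/-- The roots of type `D_l`: `±e_i ± e_j`, `i < j`. -/
def isRootD (l : ℕ) (v : Fin l → ℤ) : Prop :=
  ∃ i j : Fin l, (i:ℕ) < (j:ℕ) ∧ ∃ a b : ℤ, (a = 1 ∨ a = -1) ∧ (b = 1 ∨ b = -1) ∧
    v = fun k => if k = i then a else if k = j then b else 0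

/-- Positive roots: the first nonzero coordinate is `+1`. -/
def isPosRootD (l : ℕ) (v : Fin l → ℤ) : Prop :=
  isRootD l v ∧ ∃ i : Fin l, v i = 1 ∧ ∀ j : Fin l, (j:ℕ) < (i:ℕ) → v j = 0

/-- Negative roots: the first nonzero coordinate is `-1`. -/
def isNegRootD (l : ℕ) (v : Fin l → ℤ) : Prop :=
  isRootD l v ∧ ∃ i : Fin l, v i = -1 ∧ ∀ j : Fin l, (j:ℕ) < (i:ℕ) → v j = 0

/-- The simple roots `Δ = {α_1, …, α_l}` of `D_l`:
`α_k = e_k - e_{k+1}` (`k ≤ l-1`) and `α_l = e_{l-1} + e_l`. -/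
def simpleSetD (l : ℕ) : Set (Fin l → ℤ) :=
  {v | (∃ k : ℕ, k + 2 ≤ l ∧
          v = fun j : Fin l => if (j:ℕ) = k then 1 else if (j:ℕ) = k+1 then (-1 : ℤ) else 0) ∨
       v = fun j : Fin l => if (j:ℕ) = l-2 ∨ (j:ℕ) = l-1 then (1 : ℤ) else 0}

/-- The Bessel support `B(SO_{2l})`: Weyl elements sending every simple root to a
negative or simple root. -/
def inBesselD (l : ℕ) (σ : Equiv.Perm (Fin (2*l))) : Prop :=
  inWeylD l σ ∧ ∀ v ∈ simpleSetD l, isNegRootD l (actD l σ v) ∨ actD l σ v ∈ simpleSetD l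

/-- `θ_w = {α ∈ Δ : wα > 0}`. -/
def thetaD (l : ℕ) (σ : Equiv.Perm (Fin (2*l))) : Set (Fin l → ℤ) :=
  {v | v ∈ simpleSetD l ∧ isPosRootD l (actD l σ v)}

/-- The length of a Weyl element: the number of positive roots made negative. -/
def lenD (l : ℕ) (σ : Equiv.Perm (Fin (2*l))) : ℕ :=
  Set.ncard {v | isPosRootD l v ∧ isNegRootD l (actD l σ v)}

/-- Reflections of `W(D_l)` in this realization. -/
def isReflD (l : ℕ) (τ : Equiv.Perm (Fin (2*l))) : Prop :=
  ∃ a b : Fin (2*l), a ≠ b ∧ a ≠ revF l b ∧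
    τ = Equiv.swap a b * Equiv.swap (revF l a) (revF l b)

/-- The (combinatorial) Bruhat order: `x ≤ y` iff there is a chain from `x` to `y`
multiplying by reflections and increasing length at each step. -/
def bruhatLE (l : ℕ) : Equiv.Perm (Fin (2*l)) → Equiv.Perm (Fin (2*l)) → Prop :=
  Relation.ReflTransGen
    (fun x y => (∃ τ, isReflD l τ ∧ y = τ * x) ∧ lenD l x < lenD l y)

/-- An explicit permutation of `Fin N` built from an involutive function on `ℕ`. -/
def natPerm (N : ℕ) (g : ℕ → ℕ) (h1 : ∀ x, x < N → g x < N)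
    (h2 : ∀ x, x < N → g (g x) = x) : Equiv.Perm (Fin N) where
  toFun := fun i => ⟨g i, h1 i i.isLt⟩
  invFun := fun i => ⟨g i, h1 i i.isLt⟩
  left_inv := fun i => Fin.ext (h2 i i.isLt)
  right_inv := fun i => Fin.ext (h2 i i.isLt)

/-- The underlying function of the Weyl representative `w̃_n`. -/
def wtnFun (l n : ℕ) (x : ℕ) : ℕ :=
  if x < n then x + (2*l - n)
  else if 2*l - n ≤ x then x - (2*l - n)
  else if n % 2 = 1 ∧ x = l - 1 then l
  else if n % 2 = 1 ∧ x = l then l - 1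
  else x

lemma wtnFun_lt (l n : ℕ) (h : n + 1 ≤ l) : ∀ x, x < 2*l → wtnFun l n x < 2*l := by
  intro x hx; unfold wtnFun; split_ifs <;> omega

lemma wtnFun_invol (l n : ℕ) (h : n + 1 ≤ l) : ∀ x, x < 2*l → wtnFun l n (wtnFun l n x) = x := by
  intro x hx; unfold wtnFun; split_ifs <;> omega

/-- The Weyl representative `w̃_n` as a permutation of `Fin (2l)`:
`I_n` corners, `J_2^n` center. -/
def wtnPerm (l n : ℕ) : Equiv.Perm (Fin (2*l)) :=
  if h : n + 1 ≤ l then natPerm (2*l) (wtnFun l n) (wtnFun_lt l n h) (wtnFun_invol l n h)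
  else 1

def shFun (l x : ℕ) : ℕ := if x < l then x + l else x - l

lemma shFun_lt (l : ℕ) : ∀ x, x < 2*l → shFun l x < 2*l := by
  intro x hx; unfold shFun; split_ifs <;> omega

lemma shFun_invol (l : ℕ) : ∀ x, x < 2*l → shFun l (shFun l x) = x := by
  intro x hx; unfold shFun; split_ifs <;> omega

/-- The permutation swapping the two halves of `Fin (2l)` (the element `[[0,I_l],[I_l,0]]`). -/
def shPerm (l : ℕ) : Equiv.Perm (Fin (2*l)) := natPerm (2*l) (shFun l) (shFun_lt l) (shFun_invol l)

def cswapFun (l x : ℕ) : ℕ := if x = l - 1 then l else if x = l then l - 1 else x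

lemma cswapFun_lt (l : ℕ) : ∀ x, x < 2*l → cswapFun l x < 2*l := by
  intro x hx; unfold cswapFun; split_ifs <;> omega

lemma cswapFun_invol (l : ℕ) : ∀ x, x < 2*l → cswapFun l (cswapFun l x) = x := by
  intro x hx; unfold cswapFun; split_ifs <;> omega

/-- The outer automorphism `c`: the transposition of `l-1` and `l` (0-indexed). -/
def cswapPerm (l : ℕ) : Equiv.Perm (Fin (2*l)) :=
  natPerm (2*l) (cswapFun l) (cswapFun_lt l) (cswapFun_invol l)

def endSwapFun (l x : ℕ) : ℕ := if x = 0 then 2*l - 1 else if x = 2*l - 1 then 0 else x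

lemma endSwapFun_lt (l : ℕ) : ∀ x, x < 2*l → endSwapFun l x < 2*l := by
  intro x hx; unfold endSwapFun; split_ifs <;> omega

lemma endSwapFun_invol (l : ℕ) : ∀ x, x < 2*l → endSwapFun l (endSwapFun l x) = x := by
  intro x hx; unfold endSwapFun; split_ifs <;> omega

def endSwapPerm (l : ℕ) : Equiv.Perm (Fin (2*l)) :=
  natPerm (2*l) (endSwapFun l) (endSwapFun_lt l) (endSwapFun_invol l)

/-- The Weyl representative `w̃_l` (with `θ_{w̃_l} = Δ ∖ {α_l}`): for `l` even the
half-swap `w̃'_l = [[0,I_l],[I_l,0]]`, and for `l` odd its conjugate by `c`. -/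
def wtlPerm (l : ℕ) : Equiv.Perm (Fin (2*l)) :=
  if l % 2 = 1 then cswapPerm l * (shPerm l * endSwapPerm l) * cswapPerm l else shPerm l

/-- `w̃_l^c = c w̃_l c`. -/
def wtlcPerm (l : ℕ) : Equiv.Perm (Fin (2*l)) := cswapPerm l * wtlPerm l * cswapPerm l

def wlongGLFun (l x : ℕ) : ℕ := if x < l then l - 1 - x else 3*l - 1 - x

lemma wlongGLFun_lt (l : ℕ) : ∀ x, x < 2*l → wlongGLFun l x < 2*l := by
  intro x hx; unfold wlongGLFun; split_ifs <;> omega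

lemma wlongGLFun_invol (l : ℕ) : ∀ x, x < 2*l → wlongGLFun l (wlongGLFun l x) = x := by
  intro x hx; unfold wlongGLFun; split_ifs <;> omega

/-- The long Weyl element of the Siegel Levi `L_l ≅ GL_l`, i.e. `t_l(J_l)`. -/
def wlongGLPerm (l : ℕ) : Equiv.Perm (Fin (2*l)) :=
  natPerm (2*l) (wlongGLFun l) (wlongGLFun_lt l) (wlongGLFun_invol l)

def wlongGLm1Fun (l x : ℕ) : ℕ :=
  if x < l - 1 then l - 2 - x else if l + 1 ≤ x then 3*l - x else x

lemma wlongGLm1Fun_lt (l : ℕ) : ∀ x, x < 2*l → wlongGLm1Fun l x < 2*l := by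
  intro x hx; unfold wlongGLm1Fun; split_ifs <;> omega

lemma wlongGLm1Fun_invol (l : ℕ) : ∀ x, x < 2*l → wlongGLm1Fun l (wlongGLm1Fun l x) = x := by
  intro x hx; unfold wlongGLm1Fun; split_ifs <;> omega

/-- The long Weyl element of the Levi `L_{l-1,1} ≅ GL_{l-1} × GL_1`. -/
def wlongGLm1Perm (l : ℕ) : Equiv.Perm (Fin (2*l)) :=
  natPerm (2*l) (wlongGLm1Fun l) (wlongGLm1Fun_lt l) (wlongGLm1Fun_invol l)

def wlongLnFun (l n x : ℕ) : ℕ :=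
  if x < n then n - 1 - x else if 2*l - n ≤ x then 4*l - 1 - n - x else x

lemma wlongLnFun_lt (l n : ℕ) (h : n ≤ l) : ∀ x, x < 2*l → wlongLnFun l n x < 2*l := by
  intro x hx; unfold wlongLnFun; split_ifs <;> omega

lemma wlongLnFun_invol (l n : ℕ) (h : n ≤ l) :
    ∀ x, x < 2*l → wlongLnFun l n (wlongLnFun l n x) = x := by
  intro x hx; unfold wlongLnFun; split_ifs <;> omega

/-- The long Weyl element of the Levi `L_{n,1^{l-n}} ≅ GL_n × GL_1^{l-n}`. -/
def wlongLnPerm (l n : ℕ) : Equiv.Perm (Fin (2*l)) :=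
  if h : n ≤ l then natPerm (2*l) (wlongLnFun l n) (wlongLnFun_lt l n h) (wlongLnFun_invol l n h)
  else 1

/-- `τ` is the image `t_n(w')` of an element `w'` of the Weyl group `W(GL_n)`:
it preserves the first block `{0,…,n-1}`, fixes the middle `[n, 2l-n)` pointwise, and
commutes with `rev`. -/
def isGLnBlock (l n : ℕ) (τ : Equiv.Perm (Fin (2*l))) : Prop :=
  (∀ i : Fin (2*l), (i:ℕ) < n → ((τ i : Fin (2*l)) : ℕ) < n) ∧
  (∀ i : Fin (2*l), n ≤ (i:ℕ) → (i:ℕ) < 2*l - n → τ i = i) ∧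
  (∀ i, τ (revF l i) = revF l (τ i))

/-- The closed Bruhat interval `[x, y]`. -/
def bruhatInterval (l : ℕ) (x y σ : Equiv.Perm (Fin (2*l))) : Prop :=
  bruhatLE l x σ ∧ bruhatLE l σ y

/-- The signed permutations: those commuting with `revF`. -/
def CommRev (l : ℕ) (σ : Equiv.Perm (Fin (2*l))) : Prop :=
  ∀ i, σ (revF l i) = revF l (σ i)

/-- The reflection interchanging `a, b` and their mirror images. -/
def pairSwap (l : ℕ) (a b : Fin (2*l)) : Equiv.Perm (Fin (2*l)) :=
  Equiv.swap a b * Equiv.swap (revF l a) (revF l b)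

lemma revF_val (l : ℕ) (i : Fin (2*l)) : ((revF l i : Fin (2*l)) : ℕ) = 2*l-1-(i:ℕ) := rfl

lemma revF_revF (l : ℕ) (i : Fin (2*l)) : revF l (revF l i) = i := by
  have := i.isLt
  apply Fin.ext; simp only [revF_val]; omega

lemma CommRev.val {l : ℕ} {σ : Equiv.Perm (Fin (2*l))} (h : CommRev l σ) (i : Fin (2*l)) :
    ((σ (revF l i) : Fin (2*l)) : ℕ) = 2*l-1-(σ i : ℕ) := by
  rw [h i, revF_val]

lemma CommRev.mul {l : ℕ} {σ τ : Equiv.Perm (Fin (2*l))} (hσ : CommRev l σ)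
    (hτ : CommRev l τ) : CommRev l (σ * τ) := fun i => by
  rw [Equiv.Perm.mul_apply, hτ, hσ, Equiv.Perm.mul_apply]

lemma CommRev.inv {l : ℕ} {σ : Equiv.Perm (Fin (2*l))} (hσ : CommRev l σ) :
    CommRev l σ⁻¹ := fun i => by
  rw [Equiv.Perm.inv_eq_iff_eq, hσ, Equiv.Perm.coe_inv, Equiv.apply_symm_apply]

lemma pairSwap_cases {l : ℕ} {a b : Fin (2*l)} (_ : a ≠ b) (_ : a ≠ revF l b)
    (i : Fin (2*l)) :
    (i = a ∧ pairSwap l a b i = b) ∨ (i = b ∧ pairSwap l a b i = a) ∨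
    (i = revF l a ∧ pairSwap l a b i = revF l b) ∨
    (i = revF l b ∧ pairSwap l a b i = revF l a) ∨
    (i ≠ a ∧ i ≠ b ∧ i ≠ revF l a ∧ i ≠ revF l b ∧ pairSwap l a b i = i) := by
  have ha := a.isLt
  have hb := b.isLt
  have hi := i.isLt
  simp only [pairSwap, Equiv.Perm.mul_apply, Equiv.swap_apply_def]
  split_ifs <;> simp only [ne_eq, Fin.ext_iff, revF_val, and_true] at * <;> omega

lemma pairSwap_pairSwap {l : ℕ} {a b : Fin (2*l)} (hab : a ≠ b) (hab' : a ≠ revF l b)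
    (i : Fin (2*l)) : pairSwap l a b (pairSwap l a b i) = i := by
  have ha := a.isLt
  have hb := b.isLt
  have hi := i.isLt
  have h1 := pairSwap_cases hab hab' i
  have h2 := pairSwap_cases hab hab' (pairSwap l a b i)
  simp only [ne_eq, Fin.ext_iff, revF_val] at *
  omega

lemma pairSwap_left {l : ℕ} {a b : Fin (2*l)} (hab : a ≠ b) (hab' : a ≠ revF l b) :
    pairSwap l a b a = b := by
  have ha := a.isLt
  rcases pairSwap_cases hab hab' a with ⟨_, h⟩ | ⟨h, _⟩ | ⟨h, _⟩ | ⟨h, _⟩ | ⟨h, _⟩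
  · exact h
  · exact absurd h hab
  · rw [Fin.ext_iff, revF_val] at h
    omega
  · exact absurd h hab'
  · exact absurd rfl h

lemma pairSwap_right {l : ℕ} {a b : Fin (2*l)} (hab : a ≠ b) (hab' : a ≠ revF l b) :
    pairSwap l a b b = a := by
  simpa only [pairSwap_left hab hab'] using pairSwap_pairSwap hab hab' a

lemma commRev_pairSwap {l : ℕ} {a b : Fin (2*l)} (hab : a ≠ b) (hab' : a ≠ revF l b) :
    CommRev l (pairSwap l a b) := fun i => by
  have ha := a.isLt
  have hb := b.isLt
  have hi := i.isLt
  have h1 := pairSwap_cases hab hab' i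
  have h2 := pairSwap_cases hab hab' (revF l i)
  simp only [ne_eq, Fin.ext_iff, revF_val] at *
  omega

lemma pairSwap_mul {l : ℕ} {x : Equiv.Perm (Fin (2*l))} (hx : CommRev l x) (p q : Fin (2*l)) :
    pairSwap l (x p) (x q) * x = x * pairSwap l p q := by
  rw [pairSwap, pairSwap, ← hx, ← hx, mul_assoc, ← Equiv.mul_swap_eq_swap_mul,
    ← mul_assoc, ← Equiv.mul_swap_eq_swap_mul, mul_assoc]

lemma apply_pairSwap_lt {l : ℕ} {x : Equiv.Perm (Fin (2*l))} (hx : CommRev l x)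
    {p q i : Fin (2*l)} (hpq : p < q) (hpq' : p ≠ revF l q) (hi : i < pairSwap l p q i) :
    (x p < x q → x i < x (pairSwap l p q i)) ∧ (x q < x p → x (pairSwap l p q i) < x i) := by
  have := hx.val p
  have := hx.val q
  have := (x p).isLt
  have := (x q).isLt
  have := p.isLt
  have := q.isLt
  rcases pairSwap_cases hpq.ne hpq' i with
    ⟨h, h'⟩ | ⟨h, h'⟩ | ⟨h, h'⟩ | ⟨h, h'⟩ | ⟨_, _, _, _, h'⟩ <;>
    rw [h'] at hi ⊢ <;> (try subst h) <;>
    simp only [Fin.lt_def, revF_val] at * <;> omega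

/-- The inversions of `x`, as pairs of positions that are not mirror images. -/
def invPairs (l : ℕ) (x : Equiv.Perm (Fin (2*l))) : Finset (Fin (2*l) × Fin (2*l)) :=
  Finset.univ.filter fun a => a.1 < a.2 ∧ a.2 ≠ revF l a.1 ∧ x a.2 < x a.1

lemma mem_invPairs {l : ℕ} {x : Equiv.Perm (Fin (2*l))} {i j : Fin (2*l)} :
    (i, j) ∈ invPairs l x ↔ i < j ∧ j ≠ revF l i ∧ x j < x i := by
  simp [invPairs]

lemma card_invPairs_lt {l : ℕ} {x : Equiv.Perm (Fin (2*l))} (hx : CommRev l x)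
    {p q : Fin (2*l)} (hpq : p < q) (hpq' : p ≠ revF l q) (hxpq : x q < x p) :
    (invPairs l (x * pairSwap l p q)).card < (invPairs l x).card := by
  set t := pairSwap l p q with ht
  have htt : ∀ i, t (t i) = i := pairSwap_pairSwap hpq.ne hpq'
  have htr : CommRev l t := commRev_pairSwap hpq.ne hpq'
  have hc := pairSwap_cases hpq.ne hpq'
  rw [← ht] at hc
  have hp := p.isLt
  have hq := q.isLt
  have tp : t p = q := pairSwap_left hpq.ne hpq'
  have up : ∀ i, i < t i → x (t i) < x i := fun i hi =>
    (apply_pairSwap_lt hx hpq hpq' hi).2 hxpq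
  have down : ∀ i, t i < i → x i < x (t i) := fun i hi => by
    simpa only [htt] using up (t i) (by rwa [htt])
  have mirror : ∀ i j, i ≠ j → (i < t i ∧ j < t j ∨ t i < i ∧ t j < j) →
      j = revF l (t i) ∧ t j = revF l i := by
    intro i j hij h
    have hi := hc i
    have hj := hc j
    clear hc htt htr ht up down
    simp only [ne_eq, Fin.ext_iff, revF_val, Fin.lt_def] at *
    omega
  have key : ∀ i j, i < j → t j < t i → x (t j) < x (t i) → x j < x i := by
    intro i j hij h1 h2
    have hm : (i < t i ∧ j < t j ∨ t i < i ∧ t j < j) → x j < x i := fun h => by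
      obtain ⟨e1, e2⟩ := mirror i j hij.ne h
      rw [e2] at h2
      rw [e1]
      have := hx.val (t i)
      have := hx.val i
      have := (x i).isLt
      have := (x (t i)).isLt
      simp only [Fin.lt_def] at *
      omega
    rcases lt_trichotomy i (t i) with hi | hi | hi
    · rcases lt_trichotomy j (t j) with hj | hj | hj
      · exact hm (Or.inl ⟨hi, hj⟩)
      · rw [← hj] at h2
        exact h2.trans (up i hi)
      · exact ((down j hj).trans h2).trans (up i hi)
    · rw [← hi] at h1 h2
      exact (down j (h1.trans hij)).trans h2
    · exact hm (Or.inr ⟨hi, (h1.trans hi).trans hij⟩)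
  have hmem : ∀ a, a ∈ invPairs l (x * t) → (t a.1 < t a.2 → (t a.1, t a.2) ∈ invPairs l x) ∧
      (¬ t a.1 < t a.2 → a ∈ invPairs l x) := by
    rintro ⟨i, j⟩ h
    simp only [mem_invPairs, Equiv.Perm.mul_apply] at h ⊢
    obtain ⟨h1, h2, h3⟩ := h
    refine ⟨fun h => ⟨h, ?_, h3⟩, fun h => ⟨h1, h2, key i j h1 ?_ h3⟩⟩
    · rw [← htr]; exact fun h => h2 (t.injective h)
    · exact lt_of_le_of_ne (not_lt.1 h) fun h => h1.ne' (t.injective h)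
  have hpqx : (p, q) ∈ invPairs l x := by
    rw [mem_invPairs]
    refine ⟨hpq, fun h => hpq' ?_, hxpq⟩
    rw [h, revF_revF]
  have tq : t q = p := pairSwap_right hpq.ne hpq'
  refine lt_of_le_of_lt (Finset.card_le_card_of_injOn
    (t := (invPairs l x).erase (p, q))
    (fun a => if t a.1 < t a.2 then (t a.1, t a.2) else a) ?_ ?_)
    (Finset.card_erase_lt_of_mem hpqx)
  · rintro ⟨i, j⟩ h
    have h' := hmem _ h
    simp only [Finset.mem_coe, mem_invPairs, Equiv.Perm.mul_apply] at h
    simp only [Finset.coe_erase, Set.mem_sdiff, Finset.mem_coe, Set.mem_singleton_iff] at h' ⊢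
    split_ifs with hc
    · refine ⟨h'.1 hc, fun e => ?_⟩
      rw [Prod.mk.injEq] at e
      have e1 : i = q := by rw [← htt i, e.1, tp]
      have e2 : j = p := by rw [← htt j, e.2, tq]
      exact absurd h.1 (by rw [e1, e2]; exact hpq.asymm)
    · refine ⟨h'.2 hc, fun e => ?_⟩
      rw [Prod.mk.injEq] at e
      exact absurd h.2.2 (by rw [e.1, e.2, tp, tq]; exact hxpq.asymm)
  · rintro ⟨i, j⟩ h ⟨i', j'⟩ h' e
    simp only [Finset.mem_coe, mem_invPairs, Equiv.Perm.mul_apply] at h h'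
    simp only at e
    split_ifs at e with h1 h2 h2 <;> rw [Prod.mk.injEq] at e ⊢
    · exact ⟨t.injective e.1, t.injective e.2⟩
    · rw [← e.1, ← e.2, htt, htt] at h2
      exact absurd h.1 h2
    · rw [e.1, e.2, htt, htt] at h1
      exact absurd h'.1 h1
    · exact e

/-- The coordinate vector `±e_k` attached to an element of `Fin (2l)`. -/
def coordVec (l : ℕ) (i : Fin (2*l)) : Fin l → ℤ := fun k =>
  if (i : ℕ) = (k : ℕ) then 1 else if (i : ℕ) = 2*l-1-(k:ℕ) then -1 else 0

lemma coordVec_revF (l : ℕ) (i : Fin (2*l)) : coordVec l (revF l i) = -coordVec l i := by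
  funext k
  have hi := i.isLt
  have hk := k.isLt
  simp only [coordVec, revF_val, Pi.neg_apply]
  split_ifs <;> omega

lemma coordVec_injective (l : ℕ) : Function.Injective (coordVec l) := by
  intro i j h
  have hi := i.isLt
  have hj := j.isLt
  apply Fin.ext
  by_cases hil : (i : ℕ) < l
  · have := congrFun h ⟨i, hil⟩
    simp only [coordVec] at this
    split_ifs at this <;> omega
  · have := congrFun h ⟨2*l-1-i, by omega⟩
    simp only [coordVec] at this
    split_ifs at this <;> omega

lemma actD_eq (l : ℕ) (σ : Equiv.Perm (Fin (2*l))) (v : Fin l → ℤ) (k : Fin l) :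
    actD l σ v k = ∑ i : Fin l, v i * coordVec l (σ (Fin.castLE (by omega) i)) k := rfl

lemma actD_neg (l : ℕ) (σ : Equiv.Perm (Fin (2*l))) (v : Fin l → ℤ) :
    actD l σ (-v) = -actD l σ v := by
  funext k
  simp [actD_eq]

lemma actD_sub (l : ℕ) (σ : Equiv.Perm (Fin (2*l))) (v w : Fin l → ℤ) :
    actD l σ (v - w) = actD l σ v - actD l σ w := by
  funext k
  simp [actD_eq, sub_mul, Finset.sum_sub_distrib]

lemma coordVec_castLE (l : ℕ) (i j : Fin l) :
    coordVec l (Fin.castLE (by omega) i) j = if j = i then 1 else 0 := by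
  have hi := i.isLt
  have hj := j.isLt
  simp only [coordVec, Fin.val_castLE, Fin.ext_iff]
  split_ifs <;> omega

lemma castLE_or_revF (l : ℕ) (i : Fin (2*l)) :
    ∃ k : Fin l, i = Fin.castLE (by omega) k ∨ i = revF l (Fin.castLE (by omega) k) := by
  have hi := i.isLt
  by_cases h : (i : ℕ) < l
  · exact ⟨⟨i, h⟩, Or.inl rfl⟩
  · refine ⟨⟨2*l-1-i, by omega⟩, Or.inr (Fin.ext ?_)⟩
    simp only [revF_val, Fin.val_castLE]
    omega

lemma actD_coordVec {l : ℕ} {σ : Equiv.Perm (Fin (2*l))} (hσ : CommRev l σ) (i : Fin (2*l)) :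
    actD l σ (coordVec l i) = coordVec l (σ i) := by
  have key : ∀ k : Fin l, actD l σ (coordVec l (Fin.castLE (by omega) k)) =
      coordVec l (σ (Fin.castLE (by omega) k)) := fun k => by
    funext j
    simp [actD_eq, coordVec_castLE]
  obtain ⟨k, rfl | rfl⟩ := castLE_or_revF l i
  · exact key k
  · rw [hσ, coordVec_revF, coordVec_revF, actD_neg, key]

/-- A linear functional that is positive on the positive roots. -/
def heightD (l : ℕ) (v : Fin l → ℤ) : ℤ := ∑ k : Fin l, (2*l-1-2*(k:ℕ) : ℤ) * v k

lemma heightD_neg (l : ℕ) (v : Fin l → ℤ) : heightD l (-v) = -heightD l v := by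
  simp [heightD]

lemma heightD_sub (l : ℕ) (v w : Fin l → ℤ) :
    heightD l (v - w) = heightD l v - heightD l w := by
  simp [heightD, mul_sub, Finset.sum_sub_distrib]

lemma heightD_coordVec (l : ℕ) (i : Fin (2*l)) :
    heightD l (coordVec l i) = 2*l-1-2*(i:ℕ) := by
  have key : ∀ k : Fin l, heightD l (coordVec l (Fin.castLE (by omega) k)) =
      2*l-1-2*(k:ℕ) := fun k => by
    simp [heightD, coordVec_castLE]
  obtain ⟨k, rfl | rfl⟩ := castLE_or_revF l i
  · exact key k
  · have := k.isLt
    rw [coordVec_revF, heightD_neg, key]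
    simp only [revF_val, Fin.val_castLE]
    omega

lemma isPosRootD_iff {l : ℕ} {v : Fin l → ℤ} : isPosRootD l v ↔
    ∃ i j : Fin (2*l), i < j ∧ (i : ℕ) + j < 2*l-1 ∧ v = coordVec l i - coordVec l j := by
  constructor
  · rintro ⟨⟨i, j, hij, a, b, ha, hb, rfl⟩, m, hm, hm'⟩
    have hi := i.isLt
    have hj := j.isLt
    have ha1 : a = 1 := by
      have h1 := hm' i
      simp only [if_true, Fin.ext_iff] at hm h1
      split_ifs at hm <;> omega
    subst ha1
    rcases hb with rfl | rfl
    · refine ⟨Fin.castLE (by omega) i, revF l (Fin.castLE (by omega) j), ?_, ?_, ?_⟩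
      · simp only [Fin.lt_def, revF_val, Fin.val_castLE]; omega
      · simp only [revF_val, Fin.val_castLE]; omega
      · funext k
        rw [coordVec_revF, Pi.sub_apply, Pi.neg_apply, coordVec_castLE, coordVec_castLE]
        simp only [Fin.ext_iff]
        split_ifs <;> omega
    · refine ⟨Fin.castLE (by omega) i, Fin.castLE (by omega) j, ?_, ?_, ?_⟩
      · simp only [Fin.lt_def, Fin.val_castLE]; omega
      · simp only [Fin.val_castLE]; omega
      · funext k
        rw [Pi.sub_apply, coordVec_castLE, coordVec_castLE]
        simp only [Fin.ext_iff]
        split_ifs <;> omega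
  · rintro ⟨i, j, hij, hs, rfl⟩
    have hi := i.isLt
    have hj := j.isLt
    rw [Fin.lt_def] at hij
    refine ⟨?_, ⟨i, by omega⟩, ?_, fun k hk => ?_⟩
    · by_cases hjl : (j : ℕ) < l
      · refine ⟨⟨i, by omega⟩, ⟨j, hjl⟩, hij, 1, -1, Or.inl rfl, Or.inr rfl, ?_⟩
        funext k
        have hk := k.isLt
        simp only [Pi.sub_apply, coordVec, Fin.ext_iff]
        split_ifs <;> omega
      · refine ⟨⟨i, by omega⟩, ⟨2*l-1-j, by omega⟩, ?_, 1, 1, Or.inl rfl, Or.inl rfl, ?_⟩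
        · simp only; omega
        funext k
        have hk := k.isLt
        simp only [Pi.sub_apply, coordVec, Fin.ext_iff]
        split_ifs <;> omega
    · simp only [Pi.sub_apply, coordVec]
      split_ifs <;> omega
    · simp only at hk
      simp only [Pi.sub_apply, coordVec]
      split_ifs <;> omega

lemma isRootD_neg {l : ℕ} {v : Fin l → ℤ} (h : isRootD l v) : isRootD l (-v) := by
  obtain ⟨i, j, hij, a, b, ha, hb, rfl⟩ := h
  refine ⟨i, j, hij, -a, -b, by omega, by omega, ?_⟩
  funext k
  simp only [Pi.neg_apply]
  split_ifs <;> simp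

lemma isNegRootD_iff_neg {l : ℕ} {v : Fin l → ℤ} : isNegRootD l v ↔ isPosRootD l (-v) := by
  constructor
  · rintro ⟨h, i, hi, h'⟩
    exact ⟨isRootD_neg h, i, by simp [hi], fun j hj => by simp [h' j hj]⟩
  · rintro ⟨h, i, hi, h'⟩
    refine ⟨by simpa using isRootD_neg h, i, ?_, fun j hj => by simpa using h' j hj⟩
    simp only [Pi.neg_apply] at hi
    omega

lemma isPosRootD_sub_iff {l : ℕ} {i j : Fin (2*l)} (hij : j ≠ revF l i) :
    isPosRootD l (coordVec l i - coordVec l j) ↔ i < j := by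
  have hi := i.isLt
  have hj := j.isLt
  rw [ne_eq, Fin.ext_iff, revF_val] at hij
  rw [isPosRootD_iff]
  constructor
  · rintro ⟨p, q, hpq, -, h⟩
    have := congrArg (heightD l) h
    simp only [heightD_sub, heightD_coordVec] at this
    rw [Fin.lt_def] at hpq ⊢
    omega
  · intro h
    rw [Fin.lt_def] at h
    by_cases hs : (i : ℕ) + j < 2*l-1
    · exact ⟨i, j, h, hs, rfl⟩
    · refine ⟨revF l j, revF l i, ?_, ?_, ?_⟩
      · simp only [Fin.lt_def, revF_val]; omega
      · simp only [revF_val]; omega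
      · rw [coordVec_revF, coordVec_revF]; abel

lemma isNegRootD_sub_iff {l : ℕ} {i j : Fin (2*l)} (hij : j ≠ revF l i) :
    isNegRootD l (coordVec l i - coordVec l j) ↔ j < i := by
  rw [isNegRootD_iff_neg, neg_sub, isPosRootD_sub_iff]
  rintro rfl
  exact hij (revF_revF l j).symm

lemma lenD_eq_card {l : ℕ} {x : Equiv.Perm (Fin (2*l))} (hx : CommRev l x) :
    lenD l x = ((invPairs l x).filter fun a => (a.1 : ℕ) + a.2 < 2*l-1).card := by
  have hset : {v | isPosRootD l v ∧ isNegRootD l (actD l x v)} =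
      (fun a : Fin (2*l) × Fin (2*l) => coordVec l a.1 - coordVec l a.2) ''
        ((invPairs l x).filter fun a => (a.1 : ℕ) + a.2 < 2*l-1 : Finset _) := by
    ext v
    constructor
    · rintro ⟨hv, hv'⟩
      obtain ⟨i, j, hij, hs, rfl⟩ := isPosRootD_iff.1 hv
      have hne : j ≠ revF l i := by
        rw [ne_eq, Fin.ext_iff, revF_val]; omega
      rw [actD_sub, actD_coordVec hx, actD_coordVec hx, isNegRootD_sub_iff
        (by rw [← hx]; exact fun h => hne (x.injective h))] at hv'
      refine ⟨(i, j), ?_, rfl⟩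
      rw [Finset.mem_coe, Finset.mem_filter, mem_invPairs]
      exact ⟨⟨hij, hne, hv'⟩, hs⟩
    · rintro ⟨⟨i, j⟩, h, rfl⟩
      rw [Finset.mem_coe, Finset.mem_filter, mem_invPairs] at h
      obtain ⟨⟨hij, hne, hv'⟩, hs⟩ := h
      refine ⟨isPosRootD_iff.2 ⟨i, j, hij, hs, rfl⟩, ?_⟩
      rwa [actD_sub, actD_coordVec hx, actD_coordVec hx, isNegRootD_sub_iff
        (by rw [← hx]; exact fun h => hne (x.injective h))]
  rw [lenD, hset, Set.InjOn.ncard_image, Set.ncard_coe_finset]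
  rintro ⟨i, j⟩ h ⟨i', j'⟩ h' e
  rw [Finset.mem_coe, Finset.mem_filter, mem_invPairs, Fin.lt_def] at h h'
  obtain ⟨⟨hij, -, -⟩, hs⟩ := h
  obtain ⟨⟨hij', -, -⟩, hs'⟩ := h'
  simp only at e hs hs'
  have hii : i = i' := by
    have h1 := congrFun e ⟨i, by omega⟩
    have h2 := congrFun e ⟨i', by omega⟩
    simp only [Pi.sub_apply, coordVec] at h1 h2
    apply Fin.ext
    rcases lt_trichotomy (i : ℕ) i' with h | h | h
    · split_ifs at h1 <;> omega
    · exact h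
    · split_ifs at h2 <;> omega
  subst hii
  rw [sub_right_inj] at e
  rw [coordVec_injective l e]

lemma two_mul_lenD {l : ℕ} {x : Equiv.Perm (Fin (2*l))} (hx : CommRev l x) :
    2 * lenD l x = (invPairs l x).card := by
  rw [← Finset.card_filter_add_card_filter_not (s := invPairs l x)
    (fun a => (a.1 : ℕ) + a.2 < 2*l-1), two_mul, lenD_eq_card hx]
  congr 1
  refine Finset.card_nbij' (fun a => (revF l a.2, revF l a.1))
    (fun a => (revF l a.2, revF l a.1)) ?_ ?_ ?_ ?_
  · rintro ⟨i, j⟩ h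
    have := hx.val i
    have := hx.val j
    have := (x i).isLt
    have := (x j).isLt
    simp only [Finset.coe_filter, Set.mem_ofPred_eq, mem_invPairs, ne_eq, Fin.ext_iff, revF_val,
      Fin.lt_def] at *
    omega
  · rintro ⟨i, j⟩ h
    have := hx.val i
    have := hx.val j
    have := (x i).isLt
    have := (x j).isLt
    simp only [Finset.coe_filter, Set.mem_ofPred_eq, mem_invPairs, ne_eq, Fin.ext_iff, revF_val,
      Fin.lt_def] at *
    omega
  · rintro ⟨i, j⟩ _
    simp only [revF_revF]
  · rintro ⟨i, j⟩ _
    simp only [revF_revF]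

lemma pairSwap_comm (l : ℕ) (a b : Fin (2*l)) : pairSwap l a b = pairSwap l b a := by
  rw [pairSwap, pairSwap, Equiv.swap_comm a, Equiv.swap_comm (revF l a)]

lemma pairSwap_mul_self {l : ℕ} {a b : Fin (2*l)} (hab : a ≠ b) (hab' : a ≠ revF l b) :
    pairSwap l a b * pairSwap l a b = 1 :=
  Equiv.ext fun i => by simpa using pairSwap_pairSwap hab hab' i

/-- Left multiplication by the reflection in the values `x p > x q`, `p < q`, shortens `x`. -/
lemma lenD_pairSwap_mul_lt {l : ℕ} {x : Equiv.Perm (Fin (2*l))} (hx : CommRev l x)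
    {p q : Fin (2*l)} (hpq : p < q) (hpq' : p ≠ revF l q) (hxpq : x q < x p) :
    lenD l (pairSwap l (x p) (x q) * x) < lenD l x := by
  have h := card_invPairs_lt hx hpq hpq' hxpq
  rw [← two_mul_lenD hx, ← two_mul_lenD (hx.mul (commRev_pairSwap hpq.ne hpq'))] at h
  rw [pairSwap_mul hx]
  omega

lemma CommRev.apply_ne_revF {l : ℕ} {x : Equiv.Perm (Fin (2*l))} (hx : CommRev l x)
    {p q : Fin (2*l)} (h : p ≠ revF l q) : x p ≠ revF l (x q) := by
  rw [← hx]
  exact fun h' => h (x.injective h')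

/-- Left multiplication by the reflection in the values `x p < x q`, `p < q`, lengthens `x`. -/
lemma lenD_lt_pairSwap_mul {l : ℕ} {x : Equiv.Perm (Fin (2*l))} (hx : CommRev l x)
    {p q : Fin (2*l)} (hpq : p < q) (hpq' : p ≠ revF l q) (hxpq : x p < x q) :
    lenD l x < lenD l (pairSwap l (x p) (x q) * x) := by
  have hne := hx.apply_ne_revF hpq'
  have hp : (pairSwap l (x p) (x q) * x) p = x q := by
    rw [pairSwap_mul hx, Equiv.Perm.mul_apply, pairSwap_left hpq.ne hpq']
  have hq : (pairSwap l (x p) (x q) * x) q = x p := by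
    rw [pairSwap_mul hx, Equiv.Perm.mul_apply, pairSwap_right hpq.ne hpq']
  have h := lenD_pairSwap_mul_lt ((commRev_pairSwap hxpq.ne hne).mul hx) hpq hpq'
    (by rwa [hp, hq])
  rwa [hp, hq, pairSwap_comm, ← mul_assoc, pairSwap_mul_self hxpq.ne hne, one_mul] at h

lemma bruhatLE_of_lt {l : ℕ} {x : Equiv.Perm (Fin (2*l))} (hx : CommRev l x)
    {p q : Fin (2*l)} (hpq : p < q) (hpq' : p ≠ revF l q) (hxpq : x p < x q) :
    bruhatLE l x (pairSwap l (x p) (x q) * x) :=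
  Relation.ReflTransGen.single ⟨⟨_, ⟨x p, x q, hxpq.ne, hx.apply_ne_revF hpq', rfl⟩, rfl⟩,
    lenD_lt_pairSwap_mul hx hpq hpq' hxpq⟩

lemma bruhatLE_of_gt {l : ℕ} {x : Equiv.Perm (Fin (2*l))} (hx : CommRev l x)
    {p q : Fin (2*l)} (hpq : p < q) (hpq' : p ≠ revF l q) (hxpq : x q < x p) :
    bruhatLE l (pairSwap l (x p) (x q) * x) x := by
  refine Relation.ReflTransGen.single
    ⟨⟨_, ⟨x p, x q, hxpq.ne', hx.apply_ne_revF hpq', rfl⟩, ?_⟩,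
    lenD_pairSwap_mul_lt hx hpq hpq' hxpq⟩
  change x = pairSwap l (x p) (x q) * _
  rw [← mul_assoc, pairSwap_mul_self hxpq.ne' (hx.apply_ne_revF hpq'), one_mul]

/-- A Bruhat step is right multiplication by a reflection in positions `p < q` with
`x p < x q`. -/
lemma exists_of_step {l : ℕ} {x y τ : Equiv.Perm (Fin (2*l))} (hx : CommRev l x)
    (hτ : isReflD l τ) (hy : y = τ * x) (hlen : lenD l x < lenD l y) :
    ∃ p q : Fin (2*l), p < q ∧ p ≠ revF l q ∧ x p < x q ∧ y = x * pairSwap l p q := by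
  obtain ⟨a, b, hab, hab', rfl⟩ := hτ
  obtain ⟨p, rfl⟩ := x.surjective a
  obtain ⟨q, rfl⟩ := x.surjective b
  rw [show Equiv.swap (x p) (x q) * Equiv.swap (revF l (x p)) (revF l (x q)) =
    pairSwap l (x p) (x q) from rfl] at hy
  have hpq : p ≠ q := fun h => hab (by rw [h])
  have hpq' : p ≠ revF l q := fun h => hab' (by rw [h, hx])
  wlog hlt : p < q generalizing p q
  · refine this q p hab.symm (fun h => hab' ?_) (by rwa [pairSwap_comm]) hpq.symm
      (fun h => hpq' ?_) (lt_of_le_of_ne (not_lt.1 hlt) hpq.symm)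
    · rw [h, revF_revF]
    · rw [h, revF_revF]
  refine ⟨p, q, hlt, hpq', ?_, by rw [hy, pairSwap_mul hx]⟩
  refine lt_of_le_of_ne (not_lt.1 fun h => ?_) hab
  have := lenD_pairSwap_mul_lt hx hlt hpq' h
  rw [← hy] at this
  omega

lemma CommRev.of_bruhatLE {l : ℕ} {x y : Equiv.Perm (Fin (2*l))} (hx : CommRev l x)
    (h : bruhatLE l x y) : CommRev l y := by
  induction h with
  | refl => exact hx
  | tail _ h ih =>
    obtain ⟨⟨τ, hτ, hy⟩, hlen⟩ := h
    obtain ⟨p, q, hpq, hpq', -, rfl⟩ := exists_of_step ih hτ hy hlen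
    exact ih.mul (commRev_pairSwap hpq.ne hpq')

/-- The number of positions below `k` at which `x` takes a value at least `m`. -/
def rankCount (l : ℕ) (x : Equiv.Perm (Fin (2*l))) (k m : ℕ) : ℕ :=
  (Finset.univ.filter fun i : Fin (2*l) => (i : ℕ) < k ∧ m ≤ (x i : ℕ)).card

lemma rankCount_le_of_bruhatLE {l : ℕ} {x y : Equiv.Perm (Fin (2*l))} (hx : CommRev l x)
    (h : bruhatLE l x y) (k m : ℕ) : rankCount l x k m ≤ rankCount l y k m := by
  induction h with
  | refl => exact le_rfl
  | tail hxz h ih =>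
    rename_i z y
    refine ih.trans ?_
    have hz := hx.of_bruhatLE hxz
    obtain ⟨⟨τ, hτ, hy⟩, hlen⟩ := h
    obtain ⟨p, q, hpq, hpq', hzpq, rfl⟩ := exists_of_step hz hτ hy hlen
    set t := pairSwap l p q with ht
    have htt : ∀ i, t (t i) = i := pairSwap_pairSwap hpq.ne hpq'
    have up : ∀ i, i < t i → z i < z (t i) := fun i hi =>
      (apply_pairSwap_lt hz hpq hpq' hi).1 hzpq
    refine Finset.card_le_card_of_injOn
      (fun i => if ((t i : Fin (2*l)) : ℕ) < k then t i else i) ?_ ?_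
    · intro i hi
      replace hi := (Finset.mem_filter.1 hi).2
      refine Finset.mem_filter.2 ⟨Finset.mem_univ _, ?_⟩
      simp only [Equiv.Perm.mul_apply]
      split_ifs with h
      · exact ⟨h, by rw [htt]; exact hi.2⟩
      · refine ⟨hi.1, hi.2.trans (up i ?_).le⟩
        rw [Fin.lt_def]
        omega
    · intro i hi j hj e
      replace hi := (Finset.mem_filter.1 hi).2
      replace hj := (Finset.mem_filter.1 hj).2
      simp only at e
      split_ifs at e with h1 h2 h2
      · exact t.injective e
      · rw [← e, htt] at h2
        exact absurd hi.1 h2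
      · rw [e, htt] at h1
        exact absurd hj.1 h1
      · exact e

lemma rankCount_succ (l : ℕ) (x : Equiv.Perm (Fin (2*l))) (i : Fin (2*l)) (m : ℕ) :
    rankCount l x (i+1) m = rankCount l x i m + if m ≤ (x i : ℕ) then 1 else 0 := by
  have : (Finset.univ.filter fun j : Fin (2*l) => (j : ℕ) < i + 1 ∧ m ≤ (x j : ℕ)) =
      (Finset.univ.filter fun j : Fin (2*l) => (j : ℕ) < i ∧ m ≤ (x j : ℕ)) ∪
      (if m ≤ (x i : ℕ) then {i} else ∅) := by
    ext j
    by_cases hj : j = i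
    · subst hj
      split_ifs with h <;> simp [h]
    · have : (j : ℕ) ≠ i := fun h => hj (Fin.ext h)
      split_ifs <;> simp [hj] <;> omega
  rw [rankCount, this, Finset.card_union_of_disjoint, ← rankCount]
  · split_ifs <;> simp
  · split_ifs <;> simp

/-- `x` and `σ` agree up to permuting the first `n` values (and symmetrically the last `n`). -/
def SameCoset (l n : ℕ) (x σ : Equiv.Perm (Fin (2*l))) : Prop :=
  ∀ (i : Fin (2*l)) (m : ℕ), n ≤ m → m ≤ 2*l-n → (m ≤ (σ i : ℕ) ↔ m ≤ (x i : ℕ))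

lemma SameCoset.of_bruhatLE {l n : ℕ} {x y σ : Equiv.Perm (Fin (2*l))} (hx : CommRev l x)
    (hxy : SameCoset l n x y) (h1 : bruhatLE l x σ) (h2 : bruhatLE l σ y) :
    SameCoset l n x σ := by
  intro i m hm hm'
  have hk : ∀ k, rankCount l σ k m = rankCount l x k m := fun k => by
    have e : rankCount l y k m = rankCount l x k m := by
      simp only [rankCount, hxy _ m hm hm']
    have := rankCount_le_of_bruhatLE hx h1 k m
    have := rankCount_le_of_bruhatLE (hx.of_bruhatLE h1) h2 k m
    omega
  have h3 := rankCount_succ l σ i m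
  rw [hk, hk, rankCount_succ] at h3
  split_ifs at h3 <;> omega

lemma val_eq_card {N : ℕ} (x : Equiv.Perm (Fin N)) (i : Fin N) :
    (x i : ℕ) = (Finset.univ.filter fun j => x j < x i).card := by
  rw [← Fin.card_Iio, ← Finset.card_map x.symm.toEmbedding]
  congr 1
  ext j
  simp

/-- Two elements of a coset that order the positions of the first `n` values in the same way
coincide. -/
lemma SameCoset.eq_of_order {l n : ℕ} (hn : n ≤ l) {x σ : Equiv.Perm (Fin (2*l))}
    (hx : CommRev l x) (hσ : CommRev l σ) (h : SameCoset l n x σ)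
    (ho : ∀ i j, i < j → (x i : ℕ) < n → (x j : ℕ) < n → (σ i < σ j ↔ x i < x j)) : σ = x := by
  have hlow : ∀ i, (σ i : ℕ) < n ↔ (x i : ℕ) < n := fun i => by
    have := h i n le_rfl (by omega)
    omega
  have ho' : ∀ i j, (x i : ℕ) < n → (x j : ℕ) < n → (σ i < σ j ↔ x i < x j) := by
    intro i j hi hj
    rcases lt_trichotomy i j with hij | rfl | hij
    · exact ho i j hij hi hj
    · simp
    · have h1 := ho j i hij hj hi
      have h2 : σ i ≠ σ j := fun e => hij.ne (σ.injective e).symm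
      have h3 : x i ≠ x j := fun e => hij.ne (x.injective e).symm
      rw [← not_iff_not, not_lt, not_lt, h2.symm.le_iff_lt, h3.symm.le_iff_lt]
      exact h1
  have heq : ∀ i, (x i : ℕ) < n → (σ i : ℕ) = x i := by
    intro i hi
    rw [val_eq_card, val_eq_card]
    congr 1
    ext j
    simp only [Finset.mem_filter, Finset.mem_univ, true_and]
    by_cases hj : (x j : ℕ) < n
    · exact ho' j i hj hi
    · have := (hlow i).2 hi
      have := mt (hlow j).1 hj
      rw [Fin.lt_def, Fin.lt_def]
      omega
  ext i
  have h1 := heq i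
  have h2 := heq (revF l i)
  have h3 := h i (x i)
  have h4 := h i (x i + 1)
  rw [hx.val, hσ.val] at h2
  have := (x i).isLt
  have := (σ i).isLt
  omega

lemma SameCoset.pairSwap_mul {l n : ℕ} {x σ : Equiv.Perm (Fin (2*l))}
    (h : SameCoset l n x σ) {a b : Fin (2*l)} (hab : a ≠ b) (hab' : a ≠ revF l b)
    (ha : (a : ℕ) < n) (hb : (b : ℕ) < n) : SameCoset l n x (pairSwap l a b * σ) := by
  intro i m hm hm'
  rw [← h i m hm hm', Equiv.Perm.mul_apply]
  have h1 := pairSwap_cases hab hab' (σ i)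
  simp only [ne_eq, Fin.ext_iff, revF_val] at h1
  omega

lemma ne_revF_of_lt {l n : ℕ} (hn : n ≤ l) {a b : Fin (2*l)} (ha : (a : ℕ) < n)
    (hb : (b : ℕ) < n) : a ≠ revF l b := fun h => by
  rw [Fin.ext_iff, revF_val] at h
  omega

lemma SameCoset.bruhatLE_of_mono {l n : ℕ} (hn : n ≤ l) {x σ : Equiv.Perm (Fin (2*l))}
    (hx : CommRev l x) (hσ : CommRev l σ) (h : SameCoset l n x σ)
    (hm : ∀ i j, i < j → (x i : ℕ) < n → (x j : ℕ) < n → x i < x j) : bruhatLE l x σ := by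
  induction hN : lenD l σ using Nat.strong_induction_on generalizing σ with
  | _ N ih =>
    subst hN
    by_cases hp : ∃ p q, p < q ∧ (σ p : ℕ) < n ∧ (σ q : ℕ) < n ∧ σ q < σ p
    · obtain ⟨p, q, hpq, hp, hq, hlt⟩ := hp
      have hne := ne_revF_of_lt hn hp hq
      have hne' : p ≠ revF l q := fun e => hne (by rw [e, hσ])
      exact (ih _ (lenD_pairSwap_mul_lt hσ hpq hne' hlt)
        ((commRev_pairSwap hlt.ne' hne).mul hσ) (h.pairSwap_mul hlt.ne' hne hp hq) rfl).trans
        (bruhatLE_of_gt hσ hpq hne' hlt)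
    · push Not at hp
      rw [h.eq_of_order hn hx hσ fun i j hij hi hj => ?_]
      · exact Relation.ReflTransGen.refl
      · have h1 := h i n le_rfl (by omega)
        have h2 := h j n le_rfl (by omega)
        exact iff_of_true (lt_of_le_of_ne (hp i j hij (by omega) (by omega))
          fun e => hij.ne (σ.injective e)) (hm i j hij hi hj)

lemma SameCoset.bruhatLE_of_anti {l n : ℕ} (hn : n ≤ l) {y σ : Equiv.Perm (Fin (2*l))}
    (hy : CommRev l y) (hσ : CommRev l σ) (h : SameCoset l n y σ)
    (hm : ∀ i j, i < j → (y i : ℕ) < n → (y j : ℕ) < n → y j < y i) : bruhatLE l σ y := by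
  induction hN : Fintype.card (Fin (2*l) × Fin (2*l)) - lenD l σ
    using Nat.strong_induction_on generalizing σ with
  | _ N ih =>
    subst hN
    by_cases hp : ∃ p q, p < q ∧ (σ p : ℕ) < n ∧ (σ q : ℕ) < n ∧ σ p < σ q
    · obtain ⟨p, q, hpq, hp, hq, hlt⟩ := hp
      have hne := ne_revF_of_lt hn hp hq
      have hne' : p ≠ revF l q := fun e => hne (by rw [e, hσ])
      have hlen := lenD_lt_pairSwap_mul hσ hpq hne' hlt
      have hσ' := (commRev_pairSwap hlt.ne hne).mul hσ
      have hle := Finset.card_le_univ (invPairs l (pairSwap l (σ p) (σ q) * σ))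
      rw [← two_mul_lenD hσ'] at hle
      exact (bruhatLE_of_lt hσ hpq hne' hlt).trans
        (ih _ (by omega) hσ' (h.pairSwap_mul hlt.ne hne hp hq) rfl)
    · push Not at hp
      rw [h.eq_of_order hn hy hσ fun i j hij hi hj => ?_]
      · exact Relation.ReflTransGen.refl
      · have h1 := h i n le_rfl (by omega)
        have h2 := h j n le_rfl (by omega)
        exact iff_of_false (hp i j hij (by omega) (by omega)).not_gt (hm i j hij hi hj).not_gt

lemma SameCoset.trans_left {l n : ℕ} {x y σ : Equiv.Perm (Fin (2*l))}
    (h1 : SameCoset l n x y) (h2 : SameCoset l n x σ) : SameCoset l n y σ :=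
  fun i m hm hm' => (h2 i m hm hm').trans (h1 i m hm hm').symm

/-- The Bruhat interval between the shortest and the longest element of a coset of `W(GL_n)` is
the whole coset. -/
lemma bruhatInterval_iff_sameCoset {l n : ℕ} (hn : n ≤ l) {x y : Equiv.Perm (Fin (2*l))}
    (hx : CommRev l x) (hy : CommRev l y) (hxy : SameCoset l n x y)
    (hmono : ∀ i j, i < j → (x i : ℕ) < n → (x j : ℕ) < n → x i < x j)
    (hanti : ∀ i j, i < j → (y i : ℕ) < n → (y j : ℕ) < n → y j < y i)
    (σ : Equiv.Perm (Fin (2*l))) :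
    bruhatInterval l x y σ ↔ CommRev l σ ∧ SameCoset l n x σ :=
  ⟨fun h => ⟨hx.of_bruhatLE h.1, hxy.of_bruhatLE hx h.1 h.2⟩, fun h =>
    ⟨h.2.bruhatLE_of_mono hn hx h.1 hmono, (hxy.trans_left h.2).bruhatLE_of_anti hn hy h.1 hanti⟩⟩

lemma cswapPerm_val (l : ℕ) (i : Fin (2*l)) :
    (cswapPerm l i : ℕ) = if (i : ℕ) = l - 1 then l else if (i : ℕ) = l then l - 1 else i := rfl

lemma cswapPerm_mul_self (l : ℕ) : cswapPerm l * cswapPerm l = 1 :=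
  Equiv.ext fun i => Fin.ext (cswapFun_invol l i i.isLt)

lemma commRev_cswapPerm (l : ℕ) : CommRev l (cswapPerm l) := fun i => by
  have h1 := cswapPerm_val l i
  have h2 := cswapPerm_val l (revF l i)
  have := i.isLt
  rw [Fin.ext_iff, revF_val]
  rw [revF_val] at h2
  split_ifs at h1 h2 <;> omega

lemma cswapPerm_lt {l : ℕ} {i j : Fin (2*l)} (hij : i < j) (hne : j ≠ revF l i) :
    cswapPerm l i < cswapPerm l j := by
  simp only [ne_eq, Fin.ext_iff, Fin.lt_def, cswapPerm_val, revF_val] at *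
  split_ifs <;> omega

lemma cswapPerm_conj_conj (l : ℕ) (x : Equiv.Perm (Fin (2*l))) :
    cswapPerm l * (cswapPerm l * x * cswapPerm l) * cswapPerm l = x := by
  simp only [mul_assoc, cswapPerm_mul_self, mul_one]
  rw [← mul_assoc, cswapPerm_mul_self, one_mul]

lemma card_invPairs_le_conj {l : ℕ} {x : Equiv.Perm (Fin (2*l))} (hx : CommRev l x) :
    (invPairs l x).card ≤ (invPairs l (cswapPerm l * x * cswapPerm l)).card := by
  refine Finset.card_le_card_of_injOn (Prod.map (cswapPerm l) (cswapPerm l)) ?_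
    ((cswapPerm l).injective.prodMap (cswapPerm l).injective).injOn
  rintro ⟨i, j⟩ h
  obtain ⟨h1, h2, h3⟩ := mem_invPairs.1 h
  refine mem_invPairs.2 ⟨cswapPerm_lt h1 h2, ?_, ?_⟩
  · rw [← commRev_cswapPerm]
    exact fun e => h2 ((cswapPerm l).injective e)
  · simp only [← Equiv.Perm.mul_apply, mul_assoc, cswapPerm_mul_self, mul_one]
    refine cswapPerm_lt h3 (hx.apply_ne_revF fun e => h2 ?_)
    rw [e, revF_revF]

lemma lenD_conj {l : ℕ} {x : Equiv.Perm (Fin (2*l))} (hx : CommRev l x) :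
    lenD l (cswapPerm l * x * cswapPerm l) = lenD l x := by
  have hx' := ((commRev_cswapPerm l).mul hx).mul (commRev_cswapPerm l)
  have h1 := card_invPairs_le_conj hx
  have h2 := card_invPairs_le_conj hx'
  rw [cswapPerm_conj_conj] at h2
  rw [← two_mul_lenD hx, ← two_mul_lenD hx'] at h1 h2
  omega

lemma bruhatLE_conj {l : ℕ} {x y : Equiv.Perm (Fin (2*l))} (hx : CommRev l x)
    (h : bruhatLE l x y) :
    bruhatLE l (cswapPerm l * x * cswapPerm l) (cswapPerm l * y * cswapPerm l) := by
  induction h with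
  | refl => exact Relation.ReflTransGen.refl
  | tail hxz h ih =>
    rename_i z y
    have hz := hx.of_bruhatLE hxz
    have hy := hx.of_bruhatLE (hxz.tail h)
    obtain ⟨⟨τ, ⟨a, b, hab, hab', rfl⟩, rfl⟩, hlen⟩ := h
    refine ih.tail ⟨⟨_, ⟨cswapPerm l a, cswapPerm l b, fun e => hab ((cswapPerm l).injective e),
      (commRev_cswapPerm l).apply_ne_revF hab', rfl⟩, ?_⟩, ?_⟩
    · change _ = pairSwap l _ _ * _
      rw [mul_assoc _ z, ← mul_assoc (pairSwap _ _ _), pairSwap_mul (commRev_cswapPerm l)]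
      rfl
    · rwa [lenD_conj hz, lenD_conj hy]

lemma bruhatInterval_conj {l : ℕ} {x y σ : Equiv.Perm (Fin (2*l))} (hx : CommRev l x) :
    bruhatInterval l (cswapPerm l * x * cswapPerm l) (cswapPerm l * y * cswapPerm l) σ ↔
      bruhatInterval l x y (cswapPerm l * σ * cswapPerm l) := by
  have hx' := ((commRev_cswapPerm l).mul hx).mul (commRev_cswapPerm l)
  constructor
  · rintro ⟨h1, h2⟩
    have h3 := bruhatLE_conj hx' h1
    have h4 := bruhatLE_conj (hx'.of_bruhatLE h1) h2
    rw [cswapPerm_conj_conj] at h3 h4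
    exact ⟨h3, h4⟩
  · rintro ⟨h1, h2⟩
    have h3 := bruhatLE_conj hx h1
    have h4 := bruhatLE_conj (hx.of_bruhatLE h1) h2
    rw [cswapPerm_conj_conj] at h3 h4
    exact ⟨h3, h4⟩

lemma cswapPerm_cases (l : ℕ) (i : Fin (2*l)) :
    ((i : ℕ) = l - 1 ∧ (cswapPerm l i : ℕ) = l) ∨ ((i : ℕ) = l ∧ (cswapPerm l i : ℕ) = l - 1) ∨
    ((i : ℕ) ≠ l - 1 ∧ (i : ℕ) ≠ l ∧ (cswapPerm l i : ℕ) = i) := by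
  rw [cswapPerm_val]
  split_ifs <;> omega

lemma shPerm_cases (l : ℕ) (i : Fin (2*l)) :
    ((i : ℕ) < l ∧ (shPerm l i : ℕ) = i + l) ∨ (l ≤ (i : ℕ) ∧ (shPerm l i : ℕ) = i - l) := by
  rw [show (shPerm l i : ℕ) = shFun l i from rfl, shFun]
  split_ifs <;> omega

lemma endSwapPerm_cases (l : ℕ) (i : Fin (2*l)) :
    ((i : ℕ) = 0 ∧ (endSwapPerm l i : ℕ) = 2*l - 1) ∨
    ((i : ℕ) = 2*l - 1 ∧ (endSwapPerm l i : ℕ) = 0) ∨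
    ((i : ℕ) ≠ 0 ∧ (i : ℕ) ≠ 2*l - 1 ∧ (endSwapPerm l i : ℕ) = i) := by
  rw [show (endSwapPerm l i : ℕ) = endSwapFun l i from rfl, endSwapFun]
  split_ifs <;> omega

lemma shPerm_endSwapPerm_cases {l : ℕ} (hl : 2 ≤ l) (i : Fin (2*l)) :
    ((i : ℕ) = 0 ∧ (shPerm l (endSwapPerm l i) : ℕ) = l - 1) ∨
    ((i : ℕ) = 2*l - 1 ∧ (shPerm l (endSwapPerm l i) : ℕ) = l) ∨
    (0 < (i : ℕ) ∧ (i : ℕ) < l ∧ (shPerm l (endSwapPerm l i) : ℕ) = i + l) ∨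
    (l ≤ (i : ℕ) ∧ (i : ℕ) < 2*l - 1 ∧ (shPerm l (endSwapPerm l i) : ℕ) = i - l) := by
  have h1 := endSwapPerm_cases l i
  have h2 := shPerm_cases l (endSwapPerm l i)
  have := i.isLt
  rcases h1 with h1 | h1 | h1 <;> omega

lemma wtlPerm_cases {l : ℕ} (hl : 2 ≤ l) (i : Fin (2*l)) :
    (l % 2 = 1 ∧ (i : ℕ) = l - 1 ∧ (wtlPerm l i : ℕ) = 0) ∨
    (l % 2 = 1 ∧ (i : ℕ) = l ∧ (wtlPerm l i : ℕ) = 2*l - 1) ∨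
    (l % 2 = 1 ∧ (i : ℕ) < l - 1 ∧ (wtlPerm l i : ℕ) = i + l) ∨
    (l % 2 = 1 ∧ l + 1 ≤ (i : ℕ) ∧ (wtlPerm l i : ℕ) = i - l) ∨
    (l % 2 = 0 ∧ (i : ℕ) < l ∧ (wtlPerm l i : ℕ) = i + l) ∨
    (l % 2 = 0 ∧ l ≤ (i : ℕ) ∧ (wtlPerm l i : ℕ) = i - l) := by
  have hi := i.isLt
  by_cases h : l % 2 = 1
  · have h1 := cswapPerm_cases l i
    have h2 := shPerm_endSwapPerm_cases hl (cswapPerm l i)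
    have h3 := cswapPerm_cases l (shPerm l (endSwapPerm l (cswapPerm l i)))
    rw [wtlPerm, if_pos h]
    simp only [Equiv.Perm.mul_apply]
    rcases h1 with ⟨hp, h1⟩ | ⟨hp, h1⟩ | ⟨hp, hp', h1⟩
    · exact Or.inl ⟨h, hp, by omega⟩
    · exact Or.inr (Or.inl ⟨h, hp, by omega⟩)
    · rcases lt_or_gt_of_ne hp' with hp' | hp'
      · exact Or.inr (Or.inr (Or.inl ⟨h, by omega, by omega⟩))
      · exact Or.inr (Or.inr (Or.inr (Or.inl ⟨h, hp', by omega⟩)))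
  · have h1 := shPerm_cases l i
    have h' : l % 2 = 0 := by omega
    rw [wtlPerm, if_neg h]
    rcases h1 with h1 | h1
    · exact Or.inr (Or.inr (Or.inr (Or.inr (Or.inl ⟨h', h1⟩))))
    · exact Or.inr (Or.inr (Or.inr (Or.inr (Or.inr ⟨h', h1⟩))))

lemma le_wtlPerm_iff {l : ℕ} (hl : 2 ≤ l) (i : Fin (2*l)) : l ≤ (wtlPerm l i : ℕ) ↔
    (i : ℕ) < l - 1 ∨ ((i : ℕ) = l - 1 ∧ l % 2 = 0) ∨ ((i : ℕ) = l ∧ l % 2 = 1) := by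
  have h := wtlPerm_cases hl i
  have := i.isLt
  omega

lemma wlongGLPerm_cases (l : ℕ) (i : Fin (2*l)) :
    ((i : ℕ) < l ∧ (wlongGLPerm l i : ℕ) = l - 1 - i) ∨
    (l ≤ (i : ℕ) ∧ (wlongGLPerm l i : ℕ) = 3*l - 1 - i) := by
  rw [show (wlongGLPerm l i : ℕ) = wlongGLFun l i from rfl, wlongGLFun]
  split_ifs <;> omega

lemma wtnPerm_cases {l : ℕ} (hl : 2 ≤ l) (i : Fin (2*l)) :
    ((i : ℕ) < l - 1 ∧ (wtnPerm l (l-1) i : ℕ) = i + l + 1) ∨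
    (l + 1 ≤ (i : ℕ) ∧ (wtnPerm l (l-1) i : ℕ) = i - (l + 1)) ∨
    (((i : ℕ) = l - 1 ∨ (i : ℕ) = l) ∧ l % 2 = 0 ∧ (wtnPerm l (l-1) i : ℕ) = 2*l - 1 - i) ∨
    (((i : ℕ) = l - 1 ∨ (i : ℕ) = l) ∧ l % 2 = 1 ∧ (wtnPerm l (l-1) i : ℕ) = i) := by
  have hi := i.isLt
  rw [show (wtnPerm l (l-1) i : ℕ) = wtnFun l (l-1) i by rw [wtnPerm, dif_pos (by omega)]; rfl,
    wtnFun]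
  split_ifs <;> omega

lemma wlongGLm1Perm_cases (l : ℕ) (i : Fin (2*l)) :
    ((i : ℕ) < l - 1 ∧ (wlongGLm1Perm l i : ℕ) = l - 2 - i) ∨
    (l + 1 ≤ (i : ℕ) ∧ (wlongGLm1Perm l i : ℕ) = 3*l - i) ∨
    (l - 1 ≤ (i : ℕ) ∧ (i : ℕ) ≤ l ∧ (wlongGLm1Perm l i : ℕ) = i) := by
  rw [show (wlongGLm1Perm l i : ℕ) = wlongGLm1Fun l i from rfl, wlongGLm1Fun]
  split_ifs <;> omega

lemma wtlPerm_lt {l : ℕ} (hl : 2 ≤ l) {i j : Fin (2*l)} (hij : i < j)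
    (hi : (wtlPerm l i : ℕ) < l) (hj : (wtlPerm l j : ℕ) < l) :
    wtlPerm l i < wtlPerm l j := by
  have h1 := wtlPerm_cases hl i
  have h2 := wtlPerm_cases hl j
  rw [Fin.lt_def] at hij ⊢
  rcases h1 with h1 | h1 | h1 | h1 | h1 | h1 <;> omega

lemma wtnPerm_lt {l : ℕ} (hl : 2 ≤ l) {i j : Fin (2*l)} (hij : i < j)
    (hi : (wtnPerm l (l-1) i : ℕ) < (l-1)) (hj : (wtnPerm l (l-1) j : ℕ) < (l-1)) :
    wtnPerm l (l-1) i < wtnPerm l (l-1) j := by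
  have h1 := wtnPerm_cases hl i
  have h2 := wtnPerm_cases hl j
  rw [Fin.lt_def] at hij ⊢
  omega

lemma commRev_wtlPerm {l : ℕ} (hl : 2 ≤ l) : CommRev l (wtlPerm l) := fun i => by
  have h1 := wtlPerm_cases hl i
  have h2 := wtlPerm_cases hl (revF l i)
  have := i.isLt
  rw [Fin.ext_iff, revF_val]
  rw [revF_val] at h2
  rcases h1 with h1 | h1 | h1 | h1 | h1 | h1 <;> omega

lemma commRev_wlongGLPerm (l : ℕ) : CommRev l (wlongGLPerm l) := fun i => by
  have h1 := wlongGLPerm_cases l i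
  have h2 := wlongGLPerm_cases l (revF l i)
  have := i.isLt
  rw [Fin.ext_iff, revF_val]
  rw [revF_val] at h2
  omega

lemma commRev_wtnPerm {l : ℕ} (hl : 2 ≤ l) : CommRev l (wtnPerm l (l-1)) := fun i => by
  have h1 := wtnPerm_cases hl i
  have h2 := wtnPerm_cases hl (revF l i)
  have := i.isLt
  rw [Fin.ext_iff, revF_val]
  rw [revF_val] at h2
  omega

lemma commRev_wlongGLm1Perm (l : ℕ) : CommRev l (wlongGLm1Perm l) := fun i => by
  have h1 := wlongGLm1Perm_cases l i
  have h2 := wlongGLm1Perm_cases l (revF l i)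
  have := i.isLt
  rw [Fin.ext_iff, revF_val]
  rw [revF_val] at h2
  omega

/-- Membership in the Siegel interval. -/
lemma bruhatInterval_wtlPerm_iff {l : ℕ} (hl : 2 ≤ l) (σ : Equiv.Perm (Fin (2*l))) :
    bruhatInterval l (wtlPerm l) (wlongGLPerm l * wtlPerm l) σ ↔
      CommRev l σ ∧ SameCoset l l (wtlPerm l) σ := by
  refine bruhatInterval_iff_sameCoset le_rfl (commRev_wtlPerm hl)
    ((commRev_wlongGLPerm l).mul (commRev_wtlPerm hl)) ?_ (fun _ _ => wtlPerm_lt hl) ?_ σ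
  · intro i m hm hm'
    have h := wlongGLPerm_cases l (wtlPerm l i)
    have := (wtlPerm l i).isLt
    rw [Equiv.Perm.mul_apply]
    omega
  · intro i j hij hi hj
    have h1 := wlongGLPerm_cases l (wtlPerm l i)
    have h2 := wlongGLPerm_cases l (wtlPerm l j)
    have := (wtlPerm l i).isLt
    have := (wtlPerm l j).isLt
    rw [Equiv.Perm.mul_apply] at hi hj
    have h3 := wtlPerm_lt hl hij (by omega) (by omega)
    rw [Fin.lt_def] at h3 ⊢
    rw [Equiv.Perm.mul_apply, Equiv.Perm.mul_apply]
    omega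

lemma bruhatInterval_wtlcPerm_iff {l : ℕ} (hl : 2 ≤ l) (σ : Equiv.Perm (Fin (2*l))) :
    bruhatInterval l (wtlcPerm l)
        ((cswapPerm l * wlongGLPerm l * cswapPerm l) * wtlcPerm l) σ ↔
      bruhatInterval l (wtlPerm l) (wlongGLPerm l * wtlPerm l)
        (cswapPerm l * σ * cswapPerm l) := by
  rw [← bruhatInterval_conj (commRev_wtlPerm hl), wtlcPerm]
  have : cswapPerm l * wlongGLPerm l * cswapPerm l * (cswapPerm l * wtlPerm l * cswapPerm l) =
      cswapPerm l * (wlongGLPerm l * wtlPerm l) * cswapPerm l := by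
    simp only [mul_assoc]
    rw [← mul_assoc (cswapPerm l) (cswapPerm l), cswapPerm_mul_self, one_mul]
  rw [this]

lemma bruhatInterval_wtnPerm_iff {l : ℕ} (hl : 2 ≤ l) (σ : Equiv.Perm (Fin (2*l))) :
    bruhatInterval l (wtnPerm l (l-1)) (wlongGLm1Perm l * wtnPerm l (l-1)) σ ↔
      CommRev l σ ∧ SameCoset l (l-1) (wtnPerm l (l-1)) σ := by
  refine bruhatInterval_iff_sameCoset (Nat.sub_le l 1) (commRev_wtnPerm hl)
    ((commRev_wlongGLm1Perm l).mul (commRev_wtnPerm hl)) ?_ (fun _ _ => wtnPerm_lt hl) ?_ σ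
  · intro i m hm hm'
    have h := wlongGLm1Perm_cases l (wtnPerm l (l-1) i)
    have := (wtnPerm l (l-1) i).isLt
    rw [Equiv.Perm.mul_apply]
    omega
  · intro i j hij hi hj
    have h1 := wlongGLm1Perm_cases l (wtnPerm l (l-1) i)
    have h2 := wlongGLm1Perm_cases l (wtnPerm l (l-1) j)
    have := (wtnPerm l (l-1) i).isLt
    have := (wtnPerm l (l-1) j).isLt
    rw [Equiv.Perm.mul_apply] at hi hj
    have h3 := wtnPerm_lt hl hij (by omega) (by omega)
    rw [Fin.lt_def] at h3 ⊢
    rw [Equiv.Perm.mul_apply, Equiv.Perm.mul_apply]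
    omega

lemma sameCoset_wtnPerm_iff {l : ℕ} (hl : 2 ≤ l) (σ : Equiv.Perm (Fin (2*l))) :
    SameCoset l (l-1) (wtnPerm l (l-1)) σ ↔
      SameCoset l l (wtlPerm l) σ ∧ SameCoset l l (wtlPerm l) (cswapPerm l * σ * cswapPerm l) := by
  have conj : ∀ i, (cswapPerm l * σ * cswapPerm l) (cswapPerm l i) = cswapPerm l (σ i) :=
    fun i => by
      rw [← Equiv.Perm.mul_apply, mul_assoc, cswapPerm_mul_self, mul_one, Equiv.Perm.mul_apply]
  refine ⟨fun h => ⟨fun i m hm hm' => ?_, fun i m hm hm' => ?_⟩, fun h i m hm hm' => ?_⟩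
  · obtain rfl : m = l := by omega
    have h1 := h i m (by omega) (by omega)
    have h3 := wtnPerm_cases hl i
    rw [le_wtlPerm_iff hl, h1]
    rcases h3 with h3 | h3 | h3 | h3 <;> omega
  · obtain rfl : m = l := by omega
    obtain ⟨i, rfl⟩ := (cswapPerm m).surjective i
    rw [conj, le_wtlPerm_iff hl]
    have h1 := h i (m-1) le_rfl (by omega)
    have h2 := h i m (by omega) (by omega)
    have h3 := h i (m+1) (by omega) (by omega)
    have h4 := wtnPerm_cases hl i
    have h6 := cswapPerm_cases m i
    have h7 := cswapPerm_cases m (σ i)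
    have := i.isLt
    clear conj h
    rcases h4 with h4 | h4 | h4 | h4 <;> rcases h6 with h6 | h6 | h6 <;> omega
  · have h1 := h.1 i l le_rfl (by omega)
    have h2 := h.2 (cswapPerm l i) l le_rfl (by omega)
    rw [le_wtlPerm_iff hl] at h1 h2
    rw [conj] at h2
    have h4 := wtnPerm_cases hl i
    have h6 := cswapPerm_cases l i
    have h7 := cswapPerm_cases l (σ i)
    have := i.isLt
    have := (σ i).isLt
    have hm'' : m = l - 1 ∨ m = l ∨ m = l + 1 := by omega
    clear conj h
    rcases h6 with h6 | h6 | h6 <;> rcases h7 with h7 | h7 | h7 <;> rcases h4 with h4 | h4 | h4 | h4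
      <;> omega

lemma SameCoset.conj_eq {l : ℕ} (hl : 2 ≤ l) {σ : Equiv.Perm (Fin (2*l))}
    (h : SameCoset l (l-1) (wtnPerm l (l-1)) σ) : cswapPerm l * σ * cswapPerm l = σ := by
  ext i
  rw [Equiv.Perm.mul_apply, Equiv.Perm.mul_apply]
  have hc := cswapPerm_cases l i
  have hv : ∀ j, (σ j : ℕ) = wtnPerm l (l-1) j ∨
      ((σ j : ℕ) < l - 1 ∧ (wtnPerm l (l-1) j : ℕ) < l - 1) ∨
      (l + 1 ≤ (σ j : ℕ) ∧ l + 1 ≤ (wtnPerm l (l-1) j : ℕ)) := fun j => by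
    have h1 := h j (l-1) le_rfl (by omega)
    have h2 := h j l (by omega) (by omega)
    have h3 := h j (l+1) (by omega) (by omega)
    omega
  have h1 := hv i
  have h2 := wtnPerm_cases hl i
  by_cases hi : (i : ℕ) = l - 1 ∨ (i : ℕ) = l
  · have h3 := hv (cswapPerm l i)
    have h4 := wtnPerm_cases hl (cswapPerm l i)
    have h5 := cswapPerm_cases l (σ (cswapPerm l i))
    clear hv h
    rcases hc with hc | hc | hc <;> rcases h4 with h4 | h4 | h4 | h4 <;> omega
  · have hci : cswapPerm l i = i := Fin.ext (by omega)
    have h5 := cswapPerm_cases l (σ i)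
    rw [hci]
    have := i.isLt
    clear hv h
    omega

lemma exists_isGLnBlock_iff {l : ℕ} (hl : 2 ≤ l) (σ : Equiv.Perm (Fin (2*l))) :
    (∃ τ, isGLnBlock l l τ ∧ σ = τ * wtlPerm l) ↔
      CommRev l σ ∧ SameCoset l l (wtlPerm l) σ := by
  constructor
  · rintro ⟨τ, ⟨h1, -, h3⟩, rfl⟩
    refine ⟨CommRev.mul h3 (commRev_wtlPerm hl), fun i m hm hm' => ?_⟩
    obtain rfl : m = l := by omega
    rw [Equiv.Perm.mul_apply]
    have h4 := h1 (wtlPerm m i)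
    have h5 := h1 (revF m (wtlPerm m i))
    rw [CommRev.val h3, revF_val] at h5
    have := (wtlPerm m i).isLt
    omega
  · rintro ⟨h1, h2⟩
    refine ⟨σ * (wtlPerm l)⁻¹, ⟨fun i hi => ?_, fun i _ _ => by omega,
      h1.mul (commRev_wtlPerm hl).inv⟩, (inv_mul_cancel_right _ _).symm⟩
    obtain ⟨i, rfl⟩ := (wtlPerm l).surjective i
    have := h2 i l le_rfl (by omega)
    rw [Equiv.Perm.mul_apply, Equiv.Perm.coe_inv, Equiv.symm_apply_apply]
    omega

/-- within the Bessel support, the intersection of the two Siegel intervals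
`[w̃_l, w_l^{L_l} w̃_l]` and `[w̃_l^c, w_l^{L_l^c} w̃_l^c]` equals
`[w̃_{l-1}, w_l^{L_{l-1,1}} w̃_{l-1}] ∩ B(SO_{2l})`; equivalently, an element of
`B(SO_{2l})` lies in both intervals iff it lies in `B_{l-1}(SO_{2l})`
(the elements `w = t_l(w') w̃_l` with `cwc = w`). -/
theorem statement15 (l : ℕ) (hl : 2 ≤ l) :
    ∀ σ : Equiv.Perm (Fin (2*l)), inBesselD l σ →
      ((bruhatInterval l (wtlPerm l) (wlongGLPerm l * wtlPerm l) σ ∧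
        bruhatInterval l (wtlcPerm l)
          ((cswapPerm l * wlongGLPerm l * cswapPerm l) * wtlcPerm l) σ) ↔
        bruhatInterval l (wtnPerm l (l-1)) (wlongGLm1Perm l * wtnPerm l (l-1)) σ) ∧
      ((bruhatInterval l (wtlPerm l) (wlongGLPerm l * wtlPerm l) σ ∧
        bruhatInterval l (wtlcPerm l)
          ((cswapPerm l * wlongGLPerm l * cswapPerm l) * wtlcPerm l) σ) ↔
        ((∃ τ, isGLnBlock l l τ ∧ σ = τ * wtlPerm l) ∧
          cswapPerm l * σ * cswapPerm l = σ)) := by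
  intro σ _
  rw [exists_isGLnBlock_iff hl, bruhatInterval_wtlcPerm_iff hl, bruhatInterval_wtlPerm_iff hl,
    bruhatInterval_wtlPerm_iff hl, bruhatInterval_wtnPerm_iff hl, sameCoset_wtnPerm_iff hl]
  refine ⟨⟨fun h => ⟨h.1.1, h.1.2, h.2.2⟩, fun h => ⟨⟨h.1, h.2.1⟩,
    ((commRev_cswapPerm l).mul h.1).mul (commRev_cswapPerm l), h.2.2⟩⟩, fun h => ⟨h.1, ?_⟩,
    fun h => ⟨h.1, by rw [h.2]; exact h.1⟩⟩
  exact SameCoset.conj_eq hl ((sameCoset_wtnPerm_iff hl σ).2 ⟨h.1.2, h.2.2⟩)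

end
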